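/- arXiv:1909.09303 — 11 statements merged into one kernel-verified Lean document; each statement's English description precedes it below -/
import Mathlib

section
/- Let {X_i}_{i∈I} be a family of T₀ topological spaces, let X = ∏_{i∈I} X_i be the product space with projections p_i, and let A_i ⊆ X_i for each i ∈ I. Then the product set ∏_{i∈I} A_i is an irreducible subset of X if and only if A_i is an irreducible subset of X_i for every i ∈ I. -/
universe u v

open Set TopologicalSpace

/-- The upper set `↑A` of a subset `A` in the specialization preorder of a topological
space, where `x ≤ y` iff `x ∈ closure {y}`. -/
def upSet (X : Type u) [TopologicalSpace X] (A : Set X) : Set X :=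
  {y | ∃ a ∈ A, a ∈ closure ({y} : Set X)}

/-- The lower set `↓A` of a subset `A` in the specialization preorder. -/
def downSet (X : Type u) [TopologicalSpace X] (A : Set X) : Set X :=
  {y | ∃ a ∈ A, y ∈ closure ({a} : Set X)}

/-- A subset `D` is directed in the specialization preorder (`x ≤ y` iff
`x ∈ closure {y}`): it is nonempty and each two members have an upper bound in `D`. -/
def SpecDirected {X : Type u} [TopologicalSpace X] (D : Set X) : Prop :=
  D.Nonempty ∧ ∀ a ∈ D, ∀ b ∈ D, ∃ c ∈ D,
    a ∈ closure ({c} : Set X) ∧ b ∈ closure ({c} : Set X)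

/-- `x` is a supremum of `D` in the specialization preorder. -/
def IsSpecSup {X : Type u} [TopologicalSpace X] (D : Set X) (x : X) : Prop :=
  (∀ d ∈ D, d ∈ closure ({x} : Set X)) ∧
    ∀ y : X, (∀ d ∈ D, d ∈ closure ({y} : Set X)) → x ∈ closure ({y} : Set X)

/-- A `d`-space: the specialization poset is a dcpo and every open set is Scott open,
i.e. inaccessible by suprema of directed sets. -/
def DSpace (X : Type u) [TopologicalSpace X] : Prop :=
  (∀ D : Set X, SpecDirected D → ∃ x : X, IsSpecSup D x) ∧
    ∀ U : Set X, IsOpen U → ∀ D : Set X, SpecDirected D → ∀ x : X,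
      IsSpecSup D x → x ∈ U → (D ∩ U).Nonempty

/-- A nonempty compact saturated subset (saturated = upper set in the
specialization preorder). -/
def IsCompactSaturated {X : Type u} [TopologicalSpace X] (K : Set X) : Prop :=
  K.Nonempty ∧ IsCompact K ∧ ∀ x ∈ K, ∀ y : X, x ∈ closure ({y} : Set X) → y ∈ K

/-- A filtered family of nonempty compact saturated sets: a nonempty family,
directed under reverse inclusion. -/
def FilteredFamily {X : Type u} [TopologicalSpace X] (𝒦 : Set (Set X)) : Prop :=
  𝒦.Nonempty ∧ (∀ K ∈ 𝒦, IsCompactSaturated K) ∧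
    ∀ K₁ ∈ 𝒦, ∀ K₂ ∈ 𝒦, ∃ K₃ ∈ 𝒦, K₃ ⊆ K₁ ∧ K₃ ⊆ K₂

/-- A well-filtered space. -/
def WellFiltered (X : Type u) [TopologicalSpace X] : Prop :=
  ∀ 𝒦 : Set (Set X), FilteredFamily 𝒦 →
    ∀ U : Set X, IsOpen U → ⋂₀ 𝒦 ⊆ U → ∃ K ∈ 𝒦, K ⊆ U

/-- A sober space: every irreducible closed subset is the closure of a unique point. -/
def SoberSpace (X : Type u) [TopologicalSpace X] : Prop :=
  ∀ A : Set X, IsIrreducible A → IsClosed A → ∃! x : X, closure ({x} : Set X) = A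

/-- The underlying set of the Smyth power space: all nonempty compact saturated subsets. -/
abbrev KSp (X : Type u) [TopologicalSpace X] : Type u := {K : Set X // IsCompactSaturated K}

/-- The Smyth power space `P_S(X)`: `K(X)` with the upper Vietoris topology, generated
by the sets `□U = {K : K ⊆ U}` for `U` open in `X`. -/
instance KSp.instTopologicalSpace (X : Type u) [TopologicalSpace X] :
    TopologicalSpace (KSp X) :=
  .generateFrom {S : Set (KSp X) | ∃ U : Set X, IsOpen U ∧ S = {K : KSp X | K.1 ⊆ U}}

/-- A Rudin set: a closed set which is minimal (under inclusion) among the closed sets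
meeting every member of some filtered family of nonempty compact saturated sets. -/
def IsRudinSet {X : Type u} [TopologicalSpace X] (A : Set X) : Prop :=
  IsClosed A ∧ ∃ 𝒦 : Set (Set X), FilteredFamily 𝒦 ∧
    (∀ K ∈ 𝒦, (A ∩ K).Nonempty) ∧
    ∀ B : Set X, IsClosed B → (∀ K ∈ 𝒦, (B ∩ K).Nonempty) → B ⊆ A → B = A

/-- A Rudin space: every irreducible closed subset is a Rudin set. -/
def RudinSpace (X : Type u) [TopologicalSpace X] : Prop :=
  ∀ A : Set X, IsIrreducible A → IsClosed A → IsRudinSet A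

/-- A well-filtered determined (WD) set: for every continuous map into a well-filtered
space, the closure of the image is the closure of a unique point. -/
def IsWDSet {X : Type u} [TopologicalSpace X] (A : Set X) : Prop :=
  ∀ (Y : Type u) [TopologicalSpace Y], WellFiltered Y →
    ∀ f : X → Y, Continuous f → ∃! y : Y, closure (f '' A) = closure ({y} : Set Y)

/-- A well-filtered determined (WD) space: every irreducible closed subset is a WD set. -/
def WDSpace (X : Type u) [TopologicalSpace X] : Prop :=
  ∀ A : Set X, IsIrreducible A → IsClosed A → IsWDSet A

/-- A DC space: every irreducible closed subset is the closure of a set which is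
directed in the specialization preorder. -/
def DCSpace (X : Type u) [TopologicalSpace X] : Prop :=
  ∀ A : Set X, IsIrreducible A → IsClosed A → ∃ D : Set X, SpecDirected D ∧ A = closure D

/-- Local compactness: every open neighbourhood of a point contains a compact saturated
neighbourhood of the point. -/
def LocallyCompactSat (X : Type u) [TopologicalSpace X] : Prop :=
  ∀ x : X, ∀ U : Set X, IsOpen U → x ∈ U →
    ∃ K : Set X, IsCompactSaturated K ∧ x ∈ interior K ∧ K ⊆ U

/-- Core compactness: for every point `x` and open `U ∋ x` there is an open `V ∋ x`
way below `U`: every open cover of `U` has a finite subfamily covering `V`. -/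
def CoreCompact (X : Type u) [TopologicalSpace X] : Prop :=
  ∀ x : X, ∀ U : Set X, IsOpen U → x ∈ U →
    ∃ V : Set X, IsOpen V ∧ x ∈ V ∧
      ∀ 𝒞 : Set (Set X), (∀ W ∈ 𝒞, IsOpen W) → U ⊆ ⋃₀ 𝒞 →
        ∃ 𝒟 : Set (Set X), 𝒟 ⊆ 𝒞 ∧ 𝒟.Finite ∧ V ⊆ ⋃₀ 𝒟

/-- A product of preirreducible sets is preirreducible. -/
theorem IsPreirreducible.univ_pi {ι : Type*} {X : ι → Type*} [∀ i, TopologicalSpace (X i)]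
    {A : ∀ i, Set (X i)} (hA : ∀ i, IsPreirreducible (A i)) :
    IsPreirreducible (Set.univ.pi A) := by
  classical
  rintro u v hu hv ⟨x, hxA, hxu⟩ ⟨y, hyA, hyv⟩
  obtain ⟨I, s, hs, hsu⟩ := isOpen_pi_iff.1 hu x hxu
  obtain ⟨J, t, ht, htv⟩ := isOpen_pi_iff.1 hv y hyv
  have key : ∀ i, ∃ z ∈ A i, (i ∈ I → z ∈ s i) ∧ (i ∈ J → z ∈ t i) := by
    intro i
    have hs' : IsOpen {z | i ∈ I → z ∈ s i} := by
      by_cases hi : i ∈ I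
      · simpa [hi] using (hs i hi).1
      · simp [hi]
    have ht' : IsOpen {z | i ∈ J → z ∈ t i} := by
      by_cases hi : i ∈ J
      · simpa [hi] using (ht i hi).1
      · simp [hi]
    exact hA i _ _ hs' ht' ⟨x i, hxA i trivial, fun hi => (hs i hi).2⟩
      ⟨y i, hyA i trivial, fun hi => (ht i hi).2⟩
  choose z hzA hzs hzt using key
  exact ⟨z, fun i _ => hzA i, hsu fun i hi => hzs i hi, htv fun i hi => hzt i hi⟩

/-- For a family of T₀ spaces `X i` and subsets `A i ⊆ X i`, the product
set `∏ i, A i` is irreducible in the product space iff each `A i` is irreducible. -/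
theorem stmt0 {ι : Type u} (X : ι → Type v) [∀ i, TopologicalSpace (X i)]
    [∀ i, T0Space (X i)] (A : ∀ i, Set (X i)) :
    IsIrreducible (Set.univ.pi A : Set (∀ i, X i)) ↔ ∀ i, IsIrreducible (A i) := by
  constructor
  · intro h i
    rw [← Set.eval_image_univ_pi h.nonempty]
    exact h.image _ (continuous_apply i).continuousOn
  · exact fun h => ⟨Set.univ_pi_nonempty_iff.2 fun i => (h i).nonempty,
      IsPreirreducible.univ_pi fun i => (h i).isPreirreducible⟩
end

section
/- Let {X_i}_{i∈I} be a family of T₀ topological spaces and X = ∏_{i∈I} X_i the product space with projections p_i. If A is an irreducible closed subset of X, then A = ∏_{i∈I} p_i(A), and p_i(A) is an irreducible closed subset of X_i for each i ∈ I. -/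
universe u v

open Set TopologicalSpace

/-- An irreducible set meeting finitely many open sets meets their intersection. -/
theorem IsIrreducible.inter_biInter_nonempty {Y ι : Type*} [TopologicalSpace Y] {A : Set Y}
    (hA : IsIrreducible A) (s : Finset ι) (U : ι → Set Y) (hU : ∀ i ∈ s, IsOpen (U i))
    (hne : ∀ i ∈ s, (A ∩ U i).Nonempty) : (A ∩ ⋂ i ∈ s, U i).Nonempty := by
  classical
  induction s using Finset.induction_on with
  | empty => simpa using hA.nonempty
  | insert i s _ ih =>
    rw [Finset.set_biInter_insert]
    exact hA.isPreirreducible _ _ (hU i (s.mem_insert_self i))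
      (isOpen_biInter_finset fun j hj => hU j (Finset.mem_insert_of_mem hj))
      (hne i (s.mem_insert_self i))
      (ih (fun j hj => hU j (Finset.mem_insert_of_mem hj))
        fun j hj => hne j (Finset.mem_insert_of_mem hj))

/-- The closure of an irreducible subset of a product contains the product of the closures of
its projections. -/
theorem IsIrreducible.pi_closure_image_subset {ι : Type*} {X : ι → Type*}
    [∀ i, TopologicalSpace (X i)] {A : Set (∀ i, X i)} (hA : IsIrreducible A) :
    Set.univ.pi (fun i => closure ((fun x : ∀ j, X j => x i) '' A)) ⊆ closure A := by
  intro x hx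
  rw [mem_closure_iff]
  intro O hO hxO
  obtain ⟨s, u, hu, hsub⟩ := isOpen_pi_iff.mp hO x hxO
  obtain ⟨a, haA, ha⟩ := hA.inter_biInter_nonempty s (fun i => (fun x : ∀ j, X j => x i) ⁻¹' u i)
    (fun i hi => (hu i hi).1.preimage (continuous_apply i)) (fun i hi => by
      obtain ⟨_, hy, a, ha, rfl⟩ :=
        mem_closure_iff.mp (hx i (mem_univ i)) (u i) (hu i hi).1 (hu i hi).2
      exact ⟨a, ha, hy⟩)
  exact ⟨a, hsub fun i hi => mem_iInter₂.mp ha i hi, haA⟩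

/-- If `A` is an irreducible closed subset of a product of T₀ spaces, then
`A` is the product of its projections, and each projection is irreducible and closed. -/
theorem stmt1 {ι : Type u} (X : ι → Type v) [∀ i, TopologicalSpace (X i)]
    [∀ i, T0Space (X i)] (A : Set (∀ i, X i))
    (hA : IsIrreducible A) (hAc : IsClosed A) :
    A = Set.univ.pi (fun i => (fun x : ∀ j, X j => x i) '' A) ∧
      ∀ i, IsIrreducible ((fun x : ∀ j, X j => x i) '' A) ∧
        IsClosed ((fun x : ∀ j, X j => x i) '' A) := by
  have hsub : Set.univ.pi (fun i => closure ((fun x : ∀ j, X j => x i) '' A)) ⊆ A :=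
    hA.pi_closure_image_subset.trans hAc.closure_subset
  refine ⟨Subset.antisymm (fun x hx i _ => mem_image_of_mem _ hx)
    ((pi_mono fun i _ => subset_closure).trans hsub), fun i =>
    ⟨hA.image _ (continuous_apply i).continuousOn, isClosed_of_closure_subset fun y hy => ?_⟩⟩
  classical
  obtain ⟨a, ha⟩ := hA.nonempty
  refine ⟨Function.update a i y, hsub fun j _ => ?_, Function.update_self i y a⟩
  rcases eq_or_ne j i with rfl | hj
  · simpa using hy
  · rw [Function.update_of_ne hj]
    exact subset_closure (mem_image_of_mem _ ha)
end

section
/- For any partially ordered set P, the space (P, υ(P)), where υ(P) is the upper topology on P, is sober if and only if every subset of P that is irreducible with respect to υ(P) has a supremum in P. -/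
universe u v

open Set TopologicalSpace

/-- The upper topology on a poset: generated by the complements of principal ideals. -/
def upperTopology (P : Type u) [Preorder P] : TopologicalSpace P :=
  .generateFrom {S : Set P | ∃ a : P, S = (Set.Iic a)ᶜ}

/-- In the upper topology, a least upper bound of an irreducible set lies in its closure. -/
theorem IsIrreducible.isLUB_mem_closure_of_isUpper {P : Type*} [Preorder P] [TopologicalSpace P]
    [Topology.IsUpper P] {A : Set P} {x : P} (hA : IsIrreducible A) (hx : IsLUB A x) :
    x ∈ closure A := by
  have hbasis := isTopologicalBasis_of_subbasis (Topology.IsUpper.topology_eq_upperTopology (α := P))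
  refine hbasis.mem_closure_iff.2 ?_
  rintro _ ⟨f, ⟨hfin, hf⟩, rfl⟩ hxf
  rw [inter_comm]
  have key := isIrreducible_iff_sInter.1 hA hfin.toFinset
  rw [hfin.coe_toFinset] at key
  refine key (fun u hu => ?_) fun u hu => ?_
  · obtain ⟨a, rfl⟩ := hf (hfin.mem_toFinset.1 hu)
    exact isClosed_Iic.isOpen_compl
  · have hu' := hfin.mem_toFinset.1 hu
    obtain ⟨a, rfl⟩ := hf hu'
    by_contra hne
    refine hxf _ hu' (hx.2 fun y hy => ?_)
    by_contra hya
    exact hne ⟨y, hy, hya⟩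

/-- In the upper topology, a point whose closure is the closure of `A` is a least upper bound
of `A`. -/
theorem IsGenericPoint.isLUB_of_isUpper {P : Type*} [Preorder P] [TopologicalSpace P]
    [Topology.IsUpper P] {A : Set P} {x : P} (hx : IsGenericPoint x (closure A)) : IsLUB A x := by
  refine ⟨fun y hy => ?_, fun b hb => closure_minimal (t := Iic b) hb isClosed_Iic hx.mem⟩
  have hy' : y ∈ closure {x} := hx.def ▸ subset_closure hy
  rwa [Topology.IsUpper.closure_singleton] at hy'

/-- For a poset `P`, the space `(P, υ(P))` is sober iff every subset of `P`
irreducible with respect to the upper topology has a supremum in `P`. -/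
theorem stmt2 (P : Type u) [PartialOrder P] [t : TopologicalSpace P]
    (ht : t = upperTopology P) :
    SoberSpace P ↔ ∀ A : Set P, IsIrreducible A → ∃ x : P, IsLUB A x := by
  have : Topology.IsUpper P := ⟨by simp only [ht, upperTopology, Topology.upper, eq_comm]⟩
  constructor
  · intro h A hA
    obtain ⟨x, hx, -⟩ := h (closure A) hA.closure isClosed_closure
    exact ⟨x, IsGenericPoint.isLUB_of_isUpper hx⟩
  · intro h A hA hAc
    obtain ⟨x, hx⟩ := h A hA
    have hxA : x ∈ A := hAc.closure_eq ▸ hA.isLUB_mem_closure_of_isUpper hx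
    have hgen : IsGenericPoint x A :=
      (closure_minimal (singleton_subset_iff.2 hxA) hAc).antisymm fun y hy => by
        rw [Topology.IsUpper.closure_singleton]
        exact hx.1 hy
    exact ⟨x, hgen, fun y hy => IsGenericPoint.eq hy hgen⟩
end

section
/- For a T₀ space X the following are equivalent: (1) X is a d-space; (2) for every subset D of X that is directed in the specialization preorder and every closed set A of X with D ⊆ A, the intersection A ∩ ⋂_{d∈D} ↑d is nonempty; (3) for every subset D of X directed in the specialization preorder, closure(D) ∩ ⋂_{d∈D} ↑d is nonempty. -/
universe u v

open Set TopologicalSpace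

theorem mem_iInter_upSet_singleton {X : Type u} [TopologicalSpace X] {D : Set X} {x : X} :
    x ∈ ⋂ d ∈ D, upSet X {d} ↔ ∀ d ∈ D, d ∈ closure ({x} : Set X) := by
  simp [upSet]

/-- An upper bound of `D` lying in `closure D` is a supremum of `D`. -/
theorem IsSpecSup.of_mem_closure {X : Type u} [TopologicalSpace X] {D : Set X} {x : X}
    (hx : x ∈ closure D) (hD : ∀ d ∈ D, d ∈ closure ({x} : Set X)) : IsSpecSup D x :=
  ⟨hD, fun _ hy => closure_minimal hy isClosed_closure hx⟩

theorem DSpace.mem_closure_of_isSpecSup {X : Type u} [TopologicalSpace X] (h : DSpace X)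
    {D : Set X} (hD : SpecDirected D) {x : X} (hx : IsSpecSup D x) : x ∈ closure D := by
  by_contra hxD
  obtain ⟨d, hd, hd'⟩ := h.2 (closure D)ᶜ isClosed_closure.isOpen_compl D hD x hx hxD
  exact hd' (subset_closure hd)

theorem dSpace_iff_closure_inter_nonempty (X : Type u) [TopologicalSpace X] :
    DSpace X ↔ ∀ D : Set X, SpecDirected D →
      (closure D ∩ ⋂ d ∈ D, upSet X {d}).Nonempty := by
  refine ⟨fun h D hD => ?_, fun h => ⟨fun D hD => ?_, fun U hU D hD x hx hxU => ?_⟩⟩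
  · obtain ⟨x, hx⟩ := h.1 D hD
    exact ⟨x, h.mem_closure_of_isSpecSup hD hx, mem_iInter_upSet_singleton.2 hx.1⟩
  · obtain ⟨x, hxD, hx⟩ := h D hD
    exact ⟨x, .of_mem_closure hxD (mem_iInter_upSet_singleton.1 hx)⟩
  · obtain ⟨y, hyD, hy⟩ := h D hD
    have hxy := hx.2 y (mem_iInter_upSet_singleton.1 hy)
    have hyU : y ∈ U := by
      obtain ⟨z, hzU, rfl⟩ := mem_closure_iff.1 hxy U hU hxU
      exact hzU
    rw [inter_comm]
    exact mem_closure_iff.1 hyD U hU hyU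

/-- For a T₀ space `X`, the following are equivalent: (1) `X` is a
d-space; (2) for every directed `D` (in the specialization preorder) and closed `A`
with `D ⊆ A`, `A ∩ ⋂_{d∈D} ↑d ≠ ∅`; (3) for every directed `D`,
`closure D ∩ ⋂_{d∈D} ↑d ≠ ∅`. -/
theorem stmt4 (X : Type u) [TopologicalSpace X] [T0Space X] :
    (DSpace X ↔ ∀ D : Set X, SpecDirected D → ∀ A : Set X, IsClosed A → D ⊆ A →
        (A ∩ ⋂ d ∈ D, upSet X {d}).Nonempty) ∧
    (DSpace X ↔ ∀ D : Set X, SpecDirected D →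
        (closure D ∩ ⋂ d ∈ D, upSet X {d}).Nonempty) := by
  refine ⟨(dSpace_iff_closure_inter_nonempty X).trans ⟨fun h D hD A hA hDA => ?_,
    fun h D hD => h D hD _ isClosed_closure subset_closure⟩,
    dSpace_iff_closure_inter_nonempty X⟩
  exact (h D hD).mono (inter_subset_inter_left _ (closure_minimal hDA hA))
end

section
/- A T₀ space X is a d-space if and only if for every continuous map f : X → Y with Y a sober space and every subset D of X directed in the specialization preorder, one has ↑f(⋂_{d∈D} ↑d) = ⋂_{d∈D} ↑f(d), where ↑ on the right-hand sides is taken in the specialization preorder of Y. -/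
universe u v

open Set TopologicalSpace

theorem mem_closure_singleton_pi_Prop {ι : Type*} {y z : ι → Prop} :
    z ∈ closure ({y} : Set (ι → Prop)) ↔ ∀ i, z i → y i := by
  rw [← specializes_iff_mem_closure]
  constructor
  · intro h i hz
    exact h.mem_open (continuous_Prop.1 (continuous_apply i)) hz
  · intro h
    rw [specializes_pi]
    intro i
    by_cases hz : z i
    · have hy : y i = z i := propext ⟨fun _ ↦ hz, fun _ ↦ h i hz⟩
      rw [hy]
    · simp [Specializes, hz]

/-- Powers of the Sierpiński space are sober. -/
theorem soberSpace_pi_Prop (ι : Type u) : SoberSpace (ι → Prop) := by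
  intro A hA hAc
  let y : ι → Prop := fun i ↦ ∃ a ∈ A, a i
  have hfin : ∀ F : Finset ι, (∀ i ∈ F, y i) → ∃ a ∈ A, ∀ i ∈ F, a i := by
    intro F hF
    classical
    obtain ⟨a, ha, haF⟩ := isIrreducible_iff_sInter.1 hA (F.image fun i ↦ {a : ι → Prop | a i})
      (Finset.forall_mem_image.2 fun i _ ↦ continuous_Prop.1 (continuous_apply i))
      (Finset.forall_mem_image.2 fun i hi ↦ hF i hi)
    exact ⟨a, ha, fun i hi ↦ haF _ (Finset.mem_coe.2 (Finset.mem_image_of_mem _ hi))⟩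
  have hy : y ∈ A := by
    rw [← hAc.closure_eq, mem_closure_iff]
    intro U hU hyU
    obtain ⟨I, u, hu, hIU⟩ := isOpen_pi_iff.1 hU y hyU
    classical
    obtain ⟨a, ha, haI⟩ := hfin (I.filter y) fun i hi ↦ (Finset.mem_filter.1 hi).2
    refine ⟨a, hIU fun i hi ↦ ?_, ha⟩
    have hay : a i = y i :=
      propext ⟨fun h ↦ ⟨a, ha, h⟩, fun h ↦ haI i (Finset.mem_filter.2 ⟨hi, h⟩)⟩
    rw [hay]
    exact (hu i hi).2
  refine ⟨y, (closure_minimal (singleton_subset_iff.2 hy) hAc).antisymm fun a ha ↦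
    mem_closure_singleton_pi_Prop.2 fun i hi ↦ ⟨a, ha, hi⟩, fun z hz ↦ ?_⟩
  have hzA : z ∈ A := hz ▸ subset_closure rfl
  rw [← hz] at hy
  funext i
  exact propext ⟨fun h ↦ ⟨z, hzA, h⟩, mem_closure_singleton_pi_Prop.1 hy i⟩

theorem DSpace.upSet_image_iInter {X : Type u} {Y : Type v} [TopologicalSpace X]
    [TopologicalSpace Y] (hX : DSpace X) {f : X → Y} (hf : Continuous f) {D : Set X}
    (hD : SpecDirected D) :
    upSet Y (f '' ⋂ d ∈ D, upSet X {d}) = ⋂ d ∈ D, upSet Y {f d} := by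
  ext y
  simp only [upSet, mem_iInter, mem_ofPred_eq, mem_singleton_iff, exists_eq_left, exists_mem_image]
  constructor
  · rintro ⟨x, hx, hxy⟩ d hd
    exact closure_minimal (singleton_subset_iff.2 hxy) isClosed_closure
      ((specializes_iff_mem_closure.2 (hx d hd)).map hf).mem_closure
  · intro hy
    obtain ⟨x, hx⟩ := hX.1 D hD
    refine ⟨x, hx.1, ?_⟩
    by_contra hxy
    obtain ⟨d, hd, hdy⟩ :=
      hX.2 _ (isClosed_closure.preimage hf).isOpen_compl D hD x hx hxy
    exact hdy (hy d hd)

/-- If every directed set has an upper bound in its closure, the space is a `d`-space. -/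
theorem DSpace.of_exists_mem_closure {X : Type u} [TopologicalSpace X]
    (h : ∀ D : Set X, SpecDirected D → ∃ x ∈ closure D, ∀ d ∈ D, d ∈ closure ({x} : Set X)) :
    DSpace X := by
  refine ⟨fun D hD ↦ ?_, fun U hU D hD x hx hxU ↦ ?_⟩
  · obtain ⟨x, hxD, hx⟩ := h D hD
    exact ⟨x, hx, fun z hz ↦ closure_minimal hz isClosed_closure hxD⟩
  · obtain ⟨z, hzD, hz⟩ := h D hD
    have hzU : z ∈ U := (specializes_iff_mem_closure.2 (hx.2 z hz)).mem_open hU hxU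
    rw [inter_comm]
    exact mem_closure_iff.1 hzD U hU hzU

/-- A T₀ space `X` is a d-space iff for every continuous map `f : X → Y`
into a sober space `Y` and every set `D` directed in the specialization preorder of `X`,
`↑f(⋂_{d∈D} ↑d) = ⋂_{d∈D} ↑f(d)` (with `↑` on the right taken in `Y`). -/
theorem stmt5 (X : Type u) [TopologicalSpace X] [T0Space X] :
    DSpace X ↔
      ∀ (Y : Type u) [TopologicalSpace Y], SoberSpace Y →
        ∀ f : X → Y, Continuous f → ∀ D : Set X, SpecDirected D →
          upSet Y (f '' ⋂ d ∈ D, upSet X {d}) = ⋂ d ∈ D, upSet Y {f d} := by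
  refine ⟨fun hX Y _ _ f hf D hD ↦ hX.upSet_image_iInter hf hD, fun h ↦ ?_⟩
  refine DSpace.of_exists_mem_closure fun D hD ↦ ?_
  have key := h (Opens X → Prop) (soberSpace_pi_Prop _) (productOfMemOpens X)
    (productOfMemOpens X).continuous D hD
  have hy : (fun U : Opens X ↦ ∃ d ∈ D, d ∈ U) ∈
      ⋂ d ∈ D, upSet (Opens X → Prop) {productOfMemOpens X d} := by
    simp only [mem_iInter]
    exact fun d hd ↦ ⟨_, rfl, mem_closure_singleton_pi_Prop.2 fun U hU ↦ ⟨d, hd, hU⟩⟩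
  rw [← key] at hy
  obtain ⟨_, ⟨x, hx, rfl⟩, hxy⟩ := hy
  simp only [upSet, mem_iInter, mem_ofPred_eq, mem_singleton_iff, exists_eq_left] at hx
  refine ⟨x, mem_closure_iff.2 fun U hU hxU ↦ ?_, hx⟩
  obtain ⟨d, hd, hdU⟩ := mem_closure_singleton_pi_Prop.1 hxy ⟨U, hU⟩ hxU
  exact ⟨d, hdU, hd⟩
end

section
/- Let X be a T₀ space and 𝒜 a nonempty collection of nonempty compact saturated subsets of X. Then 𝒜 is an irreducible subset of the Smyth power space P_S(X) if and only if for every closed set A ⊆ X such that every member of 𝒜 meets A, there exists an irreducible closed set C ⊆ A, minimal among closed sets that meet every member of 𝒜, such that every member of 𝒜 meets C. -/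
universe u v

open Set TopologicalSpace

/-- Every open set of the Smyth power space is a union of basic open sets `□U`. -/
theorem KSp.exists_box_subset {X : Type u} [TopologicalSpace X] {O : Set (KSp X)}
    (hO : IsOpen O) {K : KSp X} (hK : K ∈ O) :
    ∃ U : Set X, IsOpen U ∧ K.1 ⊆ U ∧ ∀ L : KSp X, L.1 ⊆ U → L ∈ O := by
  induction hO with
  | basic S hS =>
    obtain ⟨U, hU, rfl⟩ := hS
    exact ⟨U, hU, hK, fun L hL => hL⟩
  | univ => exact ⟨Set.univ, isOpen_univ, Set.subset_univ _, fun _ _ => Set.mem_univ _⟩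
  | inter S T _ _ hS hT =>
    obtain ⟨U, hU, hKU, hUS⟩ := hS hK.1
    obtain ⟨V, hV, hKV, hVT⟩ := hT hK.2
    exact ⟨U ∩ V, hU.inter hV, Set.subset_inter hKU hKV, fun L hL =>
      ⟨hUS L (hL.trans Set.inter_subset_left), hVT L (hL.trans Set.inter_subset_right)⟩⟩
  | sUnion 𝒮 _ ih =>
    obtain ⟨S, hS, hKS⟩ := hK
    obtain ⟨U, hU, hKU, hUS⟩ := ih S hS hKS
    exact ⟨U, hU, hKU, fun L hL => ⟨S, hS, hUS L hL⟩⟩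

theorem KSp.isOpen_box {X : Type u} [TopologicalSpace X] {U : Set X} (hU : IsOpen U) :
    IsOpen {K : KSp X | K.1 ⊆ U} :=
  isOpen_generateFrom_of_mem ⟨U, hU, rfl⟩

/-- A family is preirreducible in the Smyth power space iff the basic open sets `□U` and `□V`
cannot both meet it without `□(U ∩ V)` meeting it. -/
theorem KSp.isPreirreducible_iff_box {X : Type u} [TopologicalSpace X] {𝒜 : Set (KSp X)} :
    IsPreirreducible 𝒜 ↔ ∀ U V : Set X, IsOpen U → IsOpen V →
      (∃ K ∈ 𝒜, K.1 ⊆ U) → (∃ K ∈ 𝒜, K.1 ⊆ V) → ∃ K ∈ 𝒜, K.1 ⊆ U ∩ V := by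
  refine ⟨fun h U V hU hV hKU hKV => ?_, fun h S T hS hT => ?_⟩
  · obtain ⟨K, hK, hKUV⟩ := h _ _ (isOpen_box hU) (isOpen_box hV) hKU hKV
    exact ⟨K, hK, Set.subset_inter hKUV.1 hKUV.2⟩
  · rintro ⟨K, hK, hKS⟩ ⟨L, hL, hLT⟩
    obtain ⟨U, hU, hKU, hUS⟩ := exists_box_subset hS hKS
    obtain ⟨V, hV, hLV, hVT⟩ := exists_box_subset hT hLT
    obtain ⟨M, hM, hMUV⟩ := h U V hU hV ⟨K, hK, hKU⟩ ⟨L, hL, hLV⟩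
    exact ⟨M, hM, hUS M (hMUV.trans Set.inter_subset_left),
      hVT M (hMUV.trans Set.inter_subset_right)⟩

/-- Every closed set meeting all members of a family of compact sets contains a minimal one. -/
theorem exists_minimal_closed_meeting {X : Type u} [TopologicalSpace X] {𝒦 : Set (Set X)}
    (h𝒦 : ∀ K ∈ 𝒦, IsCompact K) {A : Set X} (hA : IsClosed A)
    (hmeet : ∀ K ∈ 𝒦, (K ∩ A).Nonempty) :
    ∃ C ⊆ A, Minimal (fun B : Set X => IsClosed B ∧ ∀ K ∈ 𝒦, (K ∩ B).Nonempty) C := by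
  refine zorn_superset_nonempty {B : Set X | IsClosed B ∧ ∀ K ∈ 𝒦, (K ∩ B).Nonempty}
    (fun c hc hchain hne => ⟨⋂₀ c, ⟨isClosed_sInter fun B hB => (hc hB).1, fun K hK => ?_⟩,
      fun _ => Set.sInter_subset_of_mem⟩) A ⟨hA, hmeet⟩
  have : Nonempty c := hne.to_subtype
  rw [Set.sInter_eq_iInter]
  by_contra hempty
  obtain ⟨B, hB⟩ := (h𝒦 K hK).elim_directed_family_closed (fun B : c => (B : Set X))
    (fun B => (hc B.2).1) (Set.not_nonempty_iff_eq_empty.1 hempty)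
    fun B D => (hchain.total B.2 D.2).elim (fun hBD => ⟨B, subset_rfl, hBD⟩)
      fun hDB => ⟨D, hDB, subset_rfl⟩
  exact ((hc B.2).2 K hK).ne_empty hB

/-- A nonempty family `𝒜` of nonempty compact saturated sets is irreducible
in the Smyth power space iff every closed set `A` meeting all members of `𝒜` contains
an irreducible closed set `C`, minimal among closed sets meeting all members of `𝒜`,
which still meets all members of `𝒜`. -/
theorem stmt6 (X : Type u) [TopologicalSpace X] [T0Space X]
    (𝒜 : Set (KSp X)) (h𝒜 : 𝒜.Nonempty) :
    IsIrreducible 𝒜 ↔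
      ∀ A : Set X, IsClosed A → (∀ K ∈ 𝒜, (K.1 ∩ A).Nonempty) →
        ∃ C : Set X, IsIrreducible C ∧ IsClosed C ∧ C ⊆ A ∧
          (∀ K ∈ 𝒜, (K.1 ∩ C).Nonempty) ∧
          ∀ B : Set X, IsClosed B → (∀ K ∈ 𝒜, (K.1 ∩ B).Nonempty) → B ⊆ C → B = C := by
  constructor
  · intro h A hA hmeet
    obtain ⟨C, hCA, hC⟩ := exists_minimal_closed_meeting (𝒦 := Subtype.val '' 𝒜)
      (by rintro _ ⟨K, -, rfl⟩; exact K.2.2.1) hA (by rintro _ ⟨K, hK, rfl⟩; exact hmeet K hK)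
    simp only [Set.forall_mem_image] at hC
    obtain ⟨⟨hCc, hCm⟩, hmin⟩ := hC
    obtain ⟨K₀, hK₀⟩ := h𝒜
    refine ⟨C, ⟨(hCm hK₀).mono Set.inter_subset_right, ?_⟩, hCc, hCA, fun K hK => hCm hK,
      fun B hB hBm hBC => hBC.antisymm (hmin ⟨hB, fun K hK => hBm K hK⟩ hBC)⟩
    have missing : ∀ F, IsClosed F → ¬ C ⊆ F → ∃ K ∈ 𝒜, K.1 ⊆ (C ∩ F)ᶜ := by
      intro F hF hCF
      by_contra! hcon
      refine hCF ((hmin ⟨hCc.inter hF, fun K hK => ?_⟩ Set.inter_subset_left).trans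
        Set.inter_subset_right)
      exact Set.not_disjoint_iff_nonempty_inter.1 fun hd =>
        hcon K hK (Set.subset_compl_iff_disjoint_right.2 hd)
    rw [isPreirreducible_iff_isClosed_union_isClosed]
    intro F G hF hG hCFG
    by_contra! hcon
    obtain ⟨K, hK, hKFG⟩ := KSp.isPreirreducible_iff_box.1 h.2 _ _
      (hCc.inter hF).isOpen_compl (hCc.inter hG).isOpen_compl
      (missing F hF hcon.1) (missing G hG hcon.2)
    obtain ⟨x, hxK, hxC⟩ := hCm hK
    exact (hCFG hxC).elim (fun hx => (hKFG hxK).1 ⟨hxC, hx⟩) fun hx => (hKFG hxK).2 ⟨hxC, hx⟩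
  · refine fun h => ⟨h𝒜, KSp.isPreirreducible_iff_box.2 ?_⟩
    rintro U V hU hV ⟨K, hK, hKU⟩ ⟨L, hL, hLV⟩
    by_contra! hcon
    obtain ⟨C, hCirr, -, hCA, hCm, -⟩ := h (U ∩ V)ᶜ (hU.inter hV).isClosed_compl
      fun M hM => Set.inter_compl_nonempty_iff.2 (hcon M hM)
    rw [Set.compl_inter] at hCA
    obtain hCU | hCV := isPreirreducible_iff_isClosed_union_isClosed.1 hCirr.2 _ _
      hU.isClosed_compl hV.isClosed_compl hCA
    · obtain ⟨x, hxK, hxC⟩ := hCm K hK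
      exact hCU hxC (hKU hxK)
    · obtain ⟨x, hxL, hxC⟩ := hCm L hL
      exact hCV hxC (hLV hxL)
end

section
/- A T₀ space X is well-filtered if and only if for every continuous map f : X → Y with Y a sober space and every filtered family 𝒦 of nonempty compact saturated subsets of X, one has ↑f(⋂𝒦) = ⋂_{K∈𝒦} ↑f(K), where ↑ is taken in the specialization preorder of Y. -/
universe u v

open Set TopologicalSpace

/-- **Rudin's lemma**: a closed set meeting every member of a filtered family of compact
saturated sets contains a minimal such closed set, and that one is irreducible. -/
theorem FilteredFamily.exists_irreducible_subset {X : Type u} [TopologicalSpace X]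
    {𝒦 : Set (Set X)} (h𝒦 : FilteredFamily 𝒦) {C : Set X} (hC : IsClosed C)
    (hmeet : ∀ K ∈ 𝒦, (C ∩ K).Nonempty) :
    ∃ A ⊆ C, IsClosed A ∧ IsIrreducible A ∧ ∀ K ∈ 𝒦, (A ∩ K).Nonempty := by
  obtain ⟨hne, hcs, hdir⟩ := h𝒦
  obtain ⟨A, hAC, ⟨hA, hAK⟩, hmin⟩ := zorn_superset_nonempty
    {B : Set X | IsClosed B ∧ ∀ K ∈ 𝒦, (B ∩ K).Nonempty} (by
      intro c hc hchain hcne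
      refine ⟨⋂₀ c, ⟨isClosed_sInter fun B hB => (hc hB).1, fun K hK => ?_⟩,
        fun B hB => sInter_subset_of_mem hB⟩
      have : Nonempty c := hcne.to_subtype
      have hd : Directed (· ⊇ ·) ((↑) : c → Set X) := fun B D =>
        (hchain.total B.2 D.2).elim (fun h => ⟨B, subset_rfl, h⟩) fun h => ⟨D, h, subset_rfl⟩
      by_contra hemp
      rw [not_nonempty_iff_eq_empty, inter_comm, sInter_eq_iInter] at hemp
      obtain ⟨B, hB⟩ := (hcs K hK).2.1.elim_directed_family_closed _
        (fun B : c => (hc B.2).1) hemp hd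
      have := (hc B.2).2 K hK
      rw [inter_comm, hB] at this
      exact not_nonempty_empty this) C ⟨hC, hmeet⟩
  have miss : ∀ F, IsClosed F → ¬ A ⊆ F → ∃ K ∈ 𝒦, ¬ ((A ∩ F) ∩ K).Nonempty := by
    intro F hF hAF
    by_contra! hcon
    exact hAF fun x hx => (hmin ⟨hA.inter hF, hcon⟩ inter_subset_left hx).2
  refine ⟨A, hAC, hA, ⟨?_, ?_⟩, hAK⟩
  · obtain ⟨K, hK⟩ := hne
    exact (hAK K hK).mono inter_subset_left
  · rw [isPreirreducible_iff_isClosed_union_isClosed]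
    intro F₁ F₂ h₁ h₂ hsub
    by_contra! hcon
    obtain ⟨K₁, hK₁, hm₁⟩ := miss F₁ h₁ hcon.1
    obtain ⟨K₂, hK₂, hm₂⟩ := miss F₂ h₂ hcon.2
    obtain ⟨K₃, hK₃, h₃₁, h₃₂⟩ := hdir K₁ hK₁ K₂ hK₂
    obtain ⟨x, hxA, hxK⟩ := hAK K₃ hK₃
    rcases hsub hxA with hx | hx
    · exact hm₁ ⟨x, ⟨hxA, hx⟩, h₃₁ hxK⟩
    · exact hm₂ ⟨x, ⟨hxA, hx⟩, h₃₂ hxK⟩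

/-- The sobrification of a space: its irreducible closed subsets, the open sets being the
sets of all those meeting a given open subset. -/
def Sobrification (X : Type u) [TopologicalSpace X] : Type u := IrreducibleCloseds X

namespace Sobrification

variable {X : Type u} [TopologicalSpace X]

/-- The irreducible closed set underlying a point of the sobrification. -/
def carrier (A : Sobrification X) : Set X := IrreducibleCloseds.carrier A

theorem isIrreducible (A : Sobrification X) : IsIrreducible A.carrier :=
  IrreducibleCloseds.isIrreducible A

theorem isClosed (A : Sobrification X) : IsClosed A.carrier :=
  IrreducibleCloseds.isClosed A

theorem carrier_injective : Function.Injective (carrier : Sobrification X → Set X) :=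
  fun _ _ h => IrreducibleCloseds.ext h

instance : TopologicalSpace (Sobrification X) where
  IsOpen S := ∃ U : Set X, IsOpen U ∧ S = {A | (A.carrier ∩ U).Nonempty}
  isOpen_univ := ⟨univ, isOpen_univ, by
    ext A
    simpa using A.isIrreducible.nonempty⟩
  isOpen_inter := by
    rintro _ _ ⟨U, hU, rfl⟩ ⟨V, hV, rfl⟩
    refine ⟨U ∩ V, hU.inter hV, ?_⟩
    ext A
    exact ⟨fun h => A.isIrreducible.2 U V hU hV h.1 h.2, fun h =>
      ⟨h.mono (inter_subset_inter_right _ inter_subset_left),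
        h.mono (inter_subset_inter_right _ inter_subset_right)⟩⟩
  isOpen_sUnion := by
    intro s hs
    refine ⟨⋃₀ {U | IsOpen U ∧ {A : Sobrification X | (A.carrier ∩ U).Nonempty} ∈ s},
      isOpen_sUnion fun U hU => hU.1, ?_⟩
    ext A
    constructor
    · rintro ⟨S, hS, hAS⟩
      obtain ⟨U, hU, rfl⟩ := hs S hS
      obtain ⟨x, hxA, hxU⟩ := hAS
      exact ⟨x, hxA, U, ⟨hU, hS⟩, hxU⟩
    · rintro ⟨x, hxA, U, ⟨hU, hS⟩, hxU⟩
      exact ⟨_, hS, x, hxA, hxU⟩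

theorem isClosed_iff {S : Set (Sobrification X)} :
    IsClosed S ↔ ∃ F : Set X, IsClosed F ∧ S = {A | A.carrier ⊆ F} := by
  rw [← isOpen_compl_iff]
  constructor
  · rintro ⟨U, hU, h⟩
    refine ⟨Uᶜ, hU.isClosed_compl, ?_⟩
    rw [← compl_compl S, h]
    ext A
    simp [not_nonempty_iff_eq_empty, subset_compl_iff_disjoint_right, disjoint_iff_inter_eq_empty]
  · rintro ⟨F, hF, rfl⟩
    refine ⟨Fᶜ, hF.isOpen_compl, ?_⟩
    ext A
    simp [inter_compl_nonempty_iff]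

theorem closure_singleton (A : Sobrification X) :
    closure {A} = {B | B.carrier ⊆ A.carrier} := by
  apply Subset.antisymm
  · exact closure_minimal (by simp) (isClosed_iff.2 ⟨_, A.isClosed, rfl⟩)
  · intro B hB
    obtain ⟨F, hF, h⟩ := isClosed_iff.1 (isClosed_closure (s := {A}))
    have hA : A ∈ closure {A} := subset_closure rfl
    rw [h] at hA ⊢
    exact Subset.trans hB hA

/-- The canonical map from a space to its sobrification. -/
def of (x : X) : Sobrification X :=
  ⟨closure {x}, isIrreducible_singleton.closure, isClosed_closure⟩

@[simp]
theorem carrier_of_subset_iff {x : X} {F : Set X} (hF : IsClosed F) :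
    (of x).carrier ⊆ F ↔ x ∈ F :=
  hF.closure_subset_iff.trans singleton_subset_iff

theorem continuous_of : Continuous (of : X → Sobrification X) := by
  refine continuous_iff_isClosed.2 fun S hS => ?_
  obtain ⟨F, hF, rfl⟩ := isClosed_iff.1 hS
  convert hF using 1
  ext x
  exact carrier_of_subset_iff hF

theorem soberSpace : SoberSpace (Sobrification X) := by
  intro S hS hcl
  obtain ⟨F, hF, rfl⟩ := isClosed_iff.1 hcl
  have hFirr : IsIrreducible F := by
    refine ⟨?_, ?_⟩
    · obtain ⟨A, hA⟩ := hS.nonempty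
      exact A.isIrreducible.nonempty.mono hA
    · rw [isPreirreducible_iff_isClosed_union_isClosed]
      intro F₁ F₂ h₁ h₂ hsub
      have key := isPreirreducible_iff_isClosed_union_isClosed.1 hS.2
        {A | A.carrier ⊆ F₁} {A | A.carrier ⊆ F₂}
        (isClosed_iff.2 ⟨F₁, h₁, rfl⟩) (isClosed_iff.2 ⟨F₂, h₂, rfl⟩)
        fun A hA => isPreirreducible_iff_isClosed_union_isClosed.1 A.isIrreducible.2
          F₁ F₂ h₁ h₂ (Subset.trans hA hsub)
      exact key.imp
        (fun h x hx => (carrier_of_subset_iff h₁).1 (h ((carrier_of_subset_iff hF).2 hx)))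
        (fun h x hx => (carrier_of_subset_iff h₂).1 (h ((carrier_of_subset_iff hF).2 hx)))
  refine ⟨(⟨F, hFirr, hF⟩ : IrreducibleCloseds X), closure_singleton _, fun B hB => ?_⟩
  replace hB := (closure_singleton B).symm.trans hB
  apply carrier_injective
  apply Subset.antisymm
  · exact (Set.ext_iff.1 hB B).1 Subset.rfl
  · exact (Set.ext_iff.1 hB (⟨F, hFirr, hF⟩ : IrreducibleCloseds X)).2 Subset.rfl

end Sobrification

/-- A T₀ space `X` is well-filtered iff for every continuous `f : X → Y`
into a sober space `Y` and every filtered family `𝒦` of nonempty compact saturated sets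
of `X`, `↑f(⋂𝒦) = ⋂_{K∈𝒦} ↑f(K)` (with `↑` taken in `Y`). -/
theorem stmt8 (X : Type u) [TopologicalSpace X] [T0Space X] :
    WellFiltered X ↔
      ∀ (Y : Type u) [TopologicalSpace Y], SoberSpace Y →
        ∀ f : X → Y, Continuous f → ∀ 𝒦 : Set (Set X), FilteredFamily 𝒦 →
          upSet Y (f '' ⋂₀ 𝒦) = ⋂ K ∈ 𝒦, upSet Y (f '' K) := by
  constructor
  · intro hX Y _ _ f hf 𝒦 h𝒦
    ext y
    simp only [mem_iInter]
    constructor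
    · rintro ⟨_, ⟨x, hx, rfl⟩, hxy⟩ K hK
      exact ⟨f x, ⟨x, hx K hK, rfl⟩, hxy⟩
    · intro hy
      by_contra hcon
      obtain ⟨K, hK, hKU⟩ := hX 𝒦 h𝒦 (f ⁻¹' closure {y})ᶜ
        (isClosed_closure.preimage hf).isOpen_compl
        fun x hx hxy => hcon ⟨f x, ⟨x, hx, rfl⟩, hxy⟩
      obtain ⟨_, ⟨x, hx, rfl⟩, hxy⟩ := hy K hK
      exact hKU hx hxy
  · intro h 𝒦 h𝒦 U hU hsub
    by_contra! hcon
    obtain ⟨A, hAU, hA, hAirr, hAK⟩ := h𝒦.exists_irreducible_subset hU.isClosed_compl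
      fun K hK => by
        rw [inter_comm]
        exact inter_compl_nonempty_iff.2 (hcon K hK)
    let a : Sobrification X := (⟨A, hAirr, hA⟩ : IrreducibleCloseds X)
    have mem_iff : ∀ x, Sobrification.of x ∈ closure {a} ↔ x ∈ A := fun x => by
      rw [Sobrification.closure_singleton]
      exact Sobrification.carrier_of_subset_iff hA
    have ha : a ∈ ⋂ K ∈ 𝒦, upSet (Sobrification X) (Sobrification.of '' K) := by
      simp only [mem_iInter]
      intro K hK
      obtain ⟨x, hxA, hxK⟩ := hAK K hK
      exact ⟨_, ⟨x, hxK, rfl⟩, (mem_iff x).2 hxA⟩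
    rw [← h _ Sobrification.soberSpace _ Sobrification.continuous_of 𝒦 h𝒦] at ha
    obtain ⟨_, ⟨x, hx, rfl⟩, hxa⟩ := ha
    exact hAU ((mem_iff x).1 hxa) (hsub hx)
end

section
/- A T₀ space X is well-filtered if and only if K(X) is a dcpo under the Smyth order and, for every filtered family 𝒦 ⊆ K(X) and every closed set A of X, ↑(A ∩ ⋂𝒦) = ⋂_{K∈𝒦} ↑(A ∩ K), where ↑ is taken in the specialization preorder of X. -/
universe u v

open Set TopologicalSpace

theorem subset_upSet {X : Type u} [TopologicalSpace X] (S : Set X) : S ⊆ upSet X S :=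
  fun x hx => ⟨x, hx, subset_closure rfl⟩

theorem upSet_mono {X : Type u} [TopologicalSpace X] {S T : Set X} (h : S ⊆ T) :
    upSet X S ⊆ upSet X T :=
  fun _ ⟨a, ha, hay⟩ => ⟨a, h ha, hay⟩

theorem upSet_subset_of_isOpen {X : Type u} [TopologicalSpace X] {S U : Set X}
    (hU : IsOpen U) (h : S ⊆ U) : upSet X S ⊆ U := by
  rintro y ⟨a, ha, hay⟩
  obtain ⟨z, hzU, rfl⟩ := mem_closure_iff.1 hay U hU (h ha)
  exact hzU

/-- The upper set of a nonempty compact set is a nonempty compact saturated set. -/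
theorem IsCompact.isCompactSaturated_upSet {X : Type u} [TopologicalSpace X] {S : Set X}
    (hS : IsCompact S) (hne : S.Nonempty) : IsCompactSaturated (upSet X S) := by
  refine ⟨hne.mono (subset_upSet S), ?_, ?_⟩
  · refine isCompact_of_finite_subcover fun {ι} V hV hcov => ?_
    obtain ⟨t, ht⟩ := hS.elim_finite_subcover V hV ((subset_upSet S).trans hcov)
    exact ⟨t, upSet_subset_of_isOpen (isOpen_biUnion fun i _ => hV i) ht⟩
  · rintro x ⟨a, ha, hax⟩ y hxy
    exact ⟨a, ha, closure_minimal (singleton_subset_iff.2 hxy) isClosed_closure hax⟩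

/-- In a well-filtered space, filtered intersections of nonempty compact saturated sets
are nonempty compact saturated. -/
theorem WellFiltered.isCompactSaturated_sInter {X : Type u} [TopologicalSpace X]
    (hX : WellFiltered X) {𝒦 : Set (Set X)} (h𝒦 : FilteredFamily 𝒦) :
    IsCompactSaturated (⋂₀ 𝒦) := by
  refine ⟨?_, ?_, ?_⟩
  · by_contra hne
    obtain ⟨K, hK, hKe⟩ := hX 𝒦 h𝒦 ∅ isOpen_empty (not_nonempty_iff_eq_empty.1 hne).subset
    exact (h𝒦.2.1 K hK).1.ne_empty (subset_empty_iff.1 hKe)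
  · refine isCompact_of_finite_subcover fun {ι} V hV hcov => ?_
    obtain ⟨K, hK, hKV⟩ := hX 𝒦 h𝒦 _ (isOpen_iUnion hV) hcov
    obtain ⟨t, ht⟩ := (h𝒦.2.1 K hK).2.1.elim_finite_subcover V hV hKV
    exact ⟨t, (sInter_subset_of_mem hK).trans ht⟩
  · exact fun x hx y hxy K hK => (h𝒦.2.1 K hK).2.2 x (hx K hK) y hxy

/-- In a well-filtered space, a closed set meeting every member of a filtered family meets
its intersection. -/
theorem WellFiltered.inter_sInter_nonempty {X : Type u} [TopologicalSpace X]
    (hX : WellFiltered X) {𝒦 : Set (Set X)} (h𝒦 : FilteredFamily 𝒦) {A : Set X}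
    (hA : IsClosed A) (h : ∀ K ∈ 𝒦, (A ∩ K).Nonempty) : (A ∩ ⋂₀ 𝒦).Nonempty := by
  by_contra hne
  obtain ⟨K, hK, hKA⟩ := hX 𝒦 h𝒦 Aᶜ hA.isOpen_compl fun x hx hxA => hne ⟨x, hxA, hx⟩
  obtain ⟨x, hxA, hxK⟩ := h K hK
  exact hKA hxK hxA

/-- The upper sets of the traces on a closed set `A` of the members of a filtered family
form a filtered family, provided `A` meets every member. -/
theorem FilteredFamily.image_upSet_inter {X : Type u} [TopologicalSpace X]
    {𝒦 : Set (Set X)} (h𝒦 : FilteredFamily 𝒦) {A : Set X} (hA : IsClosed A)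
    (h : ∀ K ∈ 𝒦, (A ∩ K).Nonempty) :
    FilteredFamily ((fun K => upSet X (A ∩ K)) '' 𝒦) := by
  refine ⟨h𝒦.1.image _, ?_, ?_⟩
  · rintro _ ⟨K, hK, rfl⟩
    exact ((h𝒦.2.1 K hK).2.1.inter_left hA).isCompactSaturated_upSet (h K hK)
  · rintro _ ⟨K₁, hK₁, rfl⟩ _ ⟨K₂, hK₂, rfl⟩
    obtain ⟨K₃, hK₃, h₁, h₂⟩ := h𝒦.2.2 K₁ hK₁ K₂ hK₂
    exact ⟨_, ⟨K₃, hK₃, rfl⟩, upSet_mono (inter_subset_inter_right A h₁),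
      upSet_mono (inter_subset_inter_right A h₂)⟩

/-- A T₀ space `X` is well-filtered iff `K(X)` is a dcpo under the Smyth
order (every filtered family has a least upper bound) and
`↑(A ∩ ⋂𝒦) = ⋂_{K∈𝒦} ↑(A ∩ K)` for every filtered family `𝒦 ⊆ K(X)` and closed `A`. -/
theorem stmt10 (X : Type u) [TopologicalSpace X] [T0Space X] :
    WellFiltered X ↔
      ((∀ 𝒦 : Set (Set X), FilteredFamily 𝒦 →
          ∃ K₀ : Set X, IsCompactSaturated K₀ ∧ (∀ K ∈ 𝒦, K₀ ⊆ K) ∧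
            ∀ L : Set X, IsCompactSaturated L → (∀ K ∈ 𝒦, L ⊆ K) → L ⊆ K₀) ∧
        ∀ 𝒦 : Set (Set X), FilteredFamily 𝒦 → ∀ A : Set X, IsClosed A →
          upSet X (A ∩ ⋂₀ 𝒦) = ⋂ K ∈ 𝒦, upSet X (A ∩ K)) := by
 
  constructor
  · refine fun hX => ⟨fun 𝒦 h𝒦 => ⟨⋂₀ 𝒦, hX.isCompactSaturated_sInter h𝒦,
      fun K hK => sInter_subset_of_mem hK, fun L _ hL => subset_sInter hL⟩,
      fun 𝒦 h𝒦 A hA => Subset.antisymm ?_ ?_⟩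
    · exact subset_iInter₂ fun K hK =>
        upSet_mono (inter_subset_inter_right A (sInter_subset_of_mem hK))
    · intro x hx
      obtain ⟨a, ⟨haA, hax⟩, ha⟩ := hX.inter_sInter_nonempty h𝒦
        (hA.inter (isClosed_closure (s := {x}))) fun K hK => by
          obtain ⟨a, ⟨haA, haK⟩, hax⟩ := mem_iInter₂.1 hx K hK
          exact ⟨a, ⟨haA, hax⟩, haK⟩
      exact ⟨a, ⟨haA, ha⟩, hax⟩
  · rintro ⟨hsup, heq⟩ 𝒦 h𝒦 U hU hsub
    by_contra! hne
    have hmeet : ∀ K ∈ 𝒦, (Uᶜ ∩ K).Nonempty := fun K hK => by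
      obtain ⟨x, hxK, hxU⟩ := not_subset.1 (hne K hK)
      exact ⟨x, hxU, hxK⟩
    obtain ⟨K₀, ⟨⟨x, hx⟩, -⟩, hK₀, -⟩ :=
      hsup _ (h𝒦.image_upSet_inter hU.isClosed_compl hmeet)
    have hmem : x ∈ ⋂ K ∈ 𝒦, upSet X (Uᶜ ∩ K) :=
      mem_iInter₂.2 fun K hK => hK₀ _ ⟨K, hK, rfl⟩ hx
    rw [← heq 𝒦 h𝒦 Uᶜ hU.isClosed_compl] at hmem
    obtain ⟨a, ⟨haU, ha⟩, -⟩ := hmem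
    exact haU (hsub ha)
end

section
/- A T₀ space X is sober if and only if its Smyth power space P_S(X) is sober. -/
universe u v

open Set TopologicalSpace

/-- Open sets are upper sets in the specialization preorder. -/
theorem IsOpen.mem_of_mem_closure_singleton {X : Type u} [TopologicalSpace X] {U : Set X}
    (hU : IsOpen U) {x y : X} (hxy : x ∈ closure ({y} : Set X)) (hx : x ∈ U) : y ∈ U :=
  (specializes_iff_mem_closure.2 hxy).mem_open hU hx

/-- A point outside a compact saturated set is missed by some open neighbourhood of that set. -/
theorem IsCompactSaturated.exists_isOpen_notMem {X : Type u} [TopologicalSpace X] {K : Set X}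
    (hK : IsCompactSaturated K) {y : X} (hy : y ∉ K) : ∃ U, IsOpen U ∧ K ⊆ U ∧ y ∉ U :=
  ⟨(closure {y})ᶜ, isClosed_closure.isOpen_compl, fun x hx hxy => hy (hK.2.2 x hx y hxy),
    fun h => h (subset_closure rfl)⟩

/-- The saturation of a point is compact saturated. -/
theorem isCompactSaturated_upSet_singleton {X : Type u} [TopologicalSpace X] (x : X) :
    IsCompactSaturated (upSet X {x}) := by
  have hmem : ∀ y, y ∈ upSet X {x} ↔ y ⤳ x := fun y => by
    simp [upSet, specializes_iff_mem_closure]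
  refine ⟨⟨x, (hmem x).2 specializes_rfl⟩, ?_, fun y hy z hz => ?_⟩
  · refine isCompact_of_finite_subcover fun U hU hsub => ?_
    obtain ⟨i, hi⟩ := mem_iUnion.1 (hsub ((hmem x).2 specializes_rfl))
    exact ⟨{i}, fun y hy => by simpa using ((hmem y).1 hy).mem_open (hU i) hi⟩
  · exact (hmem z).2 ((specializes_iff_mem_closure.2 hz).trans ((hmem y).1 hy))

theorem upSet_singleton_subset_iff {X : Type u} [TopologicalSpace X] {U : Set X}
    (hU : IsOpen U) {x : X} : upSet X {x} ⊆ U ↔ x ∈ U := by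
  refine ⟨fun h => h ⟨x, rfl, subset_closure rfl⟩, ?_⟩
  rintro hx y ⟨_, rfl, hy⟩
  exact hU.mem_of_mem_closure_singleton hy hx

namespace KSp

variable {X : Type u} [TopologicalSpace X]

theorem isOpen_box_s12 {U : Set X} (hU : IsOpen U) : IsOpen {K : KSp X | K.1 ⊆ U} :=
  .basic _ ⟨U, hU, rfl⟩

theorem isTopologicalBasis_box :
    IsTopologicalBasis {S : Set (KSp X) | ∃ U : Set X, IsOpen U ∧ S = {K : KSp X | K.1 ⊆ U}} where
  exists_subset_inter := by
    rintro _ ⟨U, hU, rfl⟩ _ ⟨V, hV, rfl⟩ K ⟨hKU, hKV⟩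
    exact ⟨_, ⟨U ∩ V, hU.inter hV, rfl⟩, subset_inter hKU hKV,
      fun L hL => ⟨hL.trans inter_subset_left, hL.trans inter_subset_right⟩⟩
  sUnion_eq := eq_univ_of_forall fun K => ⟨_, ⟨univ, isOpen_univ, rfl⟩, subset_univ K.1⟩
  eq_generateFrom := rfl

theorem mem_closure_iff_box {S : Set (KSp X)} {K : KSp X} :
    K ∈ closure S ↔ ∀ U, IsOpen U → K.1 ⊆ U → ∃ L ∈ S, L.1 ⊆ U := by
  rw [isTopologicalBasis_box.mem_closure_iff]
  constructor
  · intro h U hU hK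
    obtain ⟨L, hLU, hLS⟩ := h _ ⟨U, hU, rfl⟩ hK
    exact ⟨L, hLS, hLU⟩
  · rintro h _ ⟨U, hU, rfl⟩ hK
    obtain ⟨L, hLS, hLU⟩ := h U hU hK
    exact ⟨L, hLU, hLS⟩

/-- The specialization order of the Smyth power space is reverse inclusion. -/
theorem mem_closure_singleton_iff {K L : KSp X} : L ∈ closure ({K} : Set (KSp X)) ↔ K.1 ⊆ L.1 := by
  rw [mem_closure_iff_box]
  constructor
  · intro h y hy
    by_contra hyL
    obtain ⟨U, hU, hLU, hyU⟩ := L.2.exists_isOpen_notMem hyL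
    obtain ⟨_, rfl, hKU⟩ := h U hU hLU
    exact hyU (hKU hy)
  · exact fun h U _ hLU => ⟨K, rfl, h.trans hLU⟩

theorem continuous_upSet_singleton :
    Continuous fun x : X => (⟨upSet X {x}, isCompactSaturated_upSet_singleton x⟩ : KSp X) := by
  refine continuous_generateFrom_iff.2 ?_
  rintro _ ⟨U, hU, rfl⟩
  convert hU using 1
  exact Set.ext fun x => upSet_singleton_subset_iff hU

end KSp

/-- In a sober space, if an open set `U` contains the intersection of a Scott open filter `F` of
open sets, then `U` belongs to `F` (the Hofmann–Mislove theorem). -/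
theorem SoberSpace.mem_of_sInter_subset {X : Type u} [TopologicalSpace X] (hX : SoberSpace X)
    {F : Set (Set X)} (hopen : ∀ U ∈ F, IsOpen U) (huniv : univ ∈ F)
    (hmono : ∀ U ∈ F, ∀ V, IsOpen V → U ⊆ V → V ∈ F)
    (hinter : ∀ U ∈ F, ∀ V ∈ F, U ∩ V ∈ F)
    (hscott : ∀ c : Set (Set X), (∀ U ∈ c, IsOpen U) → c.Nonempty → DirectedOn (· ⊆ ·) c →
      ⋃₀ c ∈ F → ∃ U ∈ c, U ∈ F)
    {U : Set X} (hU : IsOpen U) (hFU : ⋂₀ F ⊆ U) : U ∈ F := by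
  by_contra hUF
  obtain ⟨V, hUV, ⟨hV, hVF⟩, hmax⟩ := zorn_subset_nonempty {V | IsOpen V ∧ V ∉ F}
    (fun c hc hchain hne => ⟨⋃₀ c, ⟨isOpen_sUnion fun W hW => (hc hW).1, fun hmem => by
      obtain ⟨W, hW, hWF⟩ := hscott c (fun W hW => (hc hW).1) hne hchain.directedOn hmem
      exact (hc hW).2 hWF⟩, fun _ => subset_sUnion_of_mem⟩) U ⟨hU, hUF⟩
  have hadd : ∀ W, IsOpen W → (Vᶜ ∩ W).Nonempty → V ∪ W ∈ F := by
    rintro W hW ⟨x, hxV, hxW⟩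
    by_contra h
    exact hxV (hmax ⟨hV.union hW, h⟩ subset_union_left (Or.inr hxW))
  have hirr : IsIrreducible Vᶜ := by
    refine ⟨nonempty_compl.2 fun h => hVF (h ▸ huniv), fun W₁ W₂ h₁ h₂ hn₁ hn₂ => ?_⟩
    by_contra hempty
    refine hVF (hmono _ (hinter _ (hadd W₁ h₁ hn₁) _ (hadd W₂ h₂ hn₂)) V hV ?_)
    rw [← union_inter_distrib_left]
    refine union_subset subset_rfl fun x hx => ?_
    by_contra hxV
    exact hempty ⟨x, hxV, hx⟩
  obtain ⟨x, hx, -⟩ := hX _ hirr hV.isClosed_compl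
  have hxV : x ∈ Vᶜ := hx ▸ subset_closure rfl
  have hxF : x ∉ ⋂₀ F := fun h => hxV (hUV (hFU h))
  simp only [mem_sInter, not_forall] at hxF
  obtain ⟨W, hW, hxW⟩ := hxF
  refine hVF (hmono W hW V hV fun y hy => ?_)
  by_contra hyV
  exact hxW ((hopen W hW).mem_of_mem_closure_singleton (hx ▸ hyV : y ∈ closure {x}) hy)

theorem SoberSpace.kSp {X : Type u} [TopologicalSpace X] (hX : SoberSpace X) :
    SoberSpace (KSp X) := by
  intro A hA hAc
  let F : Set (Set X) := {U | IsOpen U ∧ ∃ K ∈ A, K.1 ⊆ U}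
  have hmono : ∀ U ∈ F, ∀ V, IsOpen V → U ⊆ V → V ∈ F := by
    rintro U ⟨-, K, hK, hKU⟩ V hV hUV
    exact ⟨hV, K, hK, hKU.trans hUV⟩
  have hmem : ∀ {U : Set X}, IsOpen U → ⋂₀ F ⊆ U → U ∈ F := by
    refine hX.mem_of_sInter_subset (fun U hU => hU.1) ?_ hmono ?_ ?_
    · obtain ⟨K, hK⟩ := hA.nonempty
      exact ⟨isOpen_univ, K, hK, subset_univ _⟩
    · rintro U ⟨hU, K, hK, hKU⟩ V ⟨hV, L, hL, hLV⟩
      obtain ⟨M, hM, hMU, hMV⟩ := hA.isPreirreducible _ _ (KSp.isOpen_box_s12 hU) (KSp.isOpen_box_s12 hV)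
        ⟨K, hK, hKU⟩ ⟨L, hL, hLV⟩
      exact ⟨hU.inter hV, M, hM, subset_inter hMU hMV⟩
    · rintro c hc hne hdir ⟨-, K, hK, hKc⟩
      have : Nonempty c := hne.to_subtype
      rw [sUnion_eq_iUnion] at hKc
      obtain ⟨U, hKU⟩ := K.2.2.1.elim_directed_cover (fun U : c => U.1) (fun U => hc U U.2) hKc
        hdir.directed_val
      exact ⟨U, U.2, hc U U.2, K, hK, hKU⟩
  have hQ : IsCompactSaturated (⋂₀ F) := by
    refine ⟨?_, isCompact_of_finite_subcover fun U hU hsub => ?_, fun x hx y hxy W hW =>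
      hW.1.mem_of_mem_closure_singleton hxy (hx W hW)⟩
    · by_contra hempty
      obtain ⟨-, K, -, hK⟩ := hmem isOpen_empty (not_nonempty_iff_eq_empty.1 hempty).subset
      exact K.2.1.ne_empty (subset_empty_iff.1 hK)
    · obtain ⟨-, K, hK, hKU⟩ := hmem (isOpen_iUnion hU) hsub
      obtain ⟨t, ht⟩ := K.2.2.1.elim_finite_subcover U hU hKU
      exact ⟨t, sInter_subset_of_mem ⟨isOpen_biUnion fun i _ => hU i, K, hK, ht⟩⟩
  have hcl : closure {(⟨⋂₀ F, hQ⟩ : KSp X)} = A := by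
    refine Subset.antisymm ?_ fun K hK => ?_
    · refine closure_minimal (singleton_subset_iff.2 ?_) hAc
      rw [← hAc.closure_eq, KSp.mem_closure_iff_box]
      exact fun U hU hQU => (hmem hU hQU).2
    · refine KSp.mem_closure_singleton_iff.2 fun y hy => ?_
      by_contra hyK
      obtain ⟨U, hU, hKU, hyU⟩ := K.2.exists_isOpen_notMem hyK
      exact hyU (hy U ⟨hU, K, hK, hKU⟩)
  refine ⟨⟨⋂₀ F, hQ⟩, hcl, fun L hL => Subtype.ext (Subset.antisymm ?_ ?_)⟩
  · exact KSp.mem_closure_singleton_iff.1 (hL.trans hcl.symm ▸ subset_closure rfl)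
  · exact KSp.mem_closure_singleton_iff.1 (hcl.trans hL.symm ▸ subset_closure rfl)

theorem SoberSpace.of_kSp {X : Type u} [TopologicalSpace X] [T0Space X]
    (hX : SoberSpace (KSp X)) : SoberSpace X := by
  intro A hA hAc
  obtain ⟨K, hK, -⟩ := hX _ (hA.image _ KSp.continuous_upSet_singleton.continuousOn).closure
    isClosed_closure
  obtain ⟨x, hxK, hxA⟩ : (K.1 ∩ A).Nonempty := by
    by_contra hempty
    have hKA : K.1 ⊆ Aᶜ := fun x hx hxA => hempty ⟨x, hx, hxA⟩
    have hKcl : K ∈ closure {K} := subset_closure rfl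
    rw [hK, KSp.mem_closure_iff_box] at hKcl
    obtain ⟨_, ⟨a, ha, rfl⟩, haA⟩ := hKcl _ hAc.isOpen_compl hKA
    exact (upSet_singleton_subset_iff hAc.isOpen_compl).1 haA ha
  have hx : closure {x} = A := by
    refine Subset.antisymm (closure_minimal (singleton_subset_iff.2 hxA) hAc) fun a ha => ?_
    have hKa := KSp.mem_closure_singleton_iff.1 (hK ▸ subset_closure (mem_image_of_mem _ ha))
    obtain ⟨_, rfl, hax⟩ := hKa hxK
    exact hax
  exact ⟨x, hx, fun y hy => (inseparable_iff_closure_eq.2 (hy.trans hx.symm)).eq⟩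

/-- A T₀ space `X` is sober iff its Smyth power space `P_S(X)` is sober. -/
theorem stmt12 (X : Type u) [TopologicalSpace X] [T0Space X] :
    SoberSpace X ↔ SoberSpace (KSp X) := by
  exact ⟨SoberSpace.kSp, SoberSpace.of_kSp⟩
end

section
/- Every locally compact T₀ space is a Rudin space, i.e., every irreducible closed subset of a locally compact T₀ space X is a minimal closed set meeting all members of some filtered family of nonempty compact saturated subsets of X. -/
universe u v

open Set TopologicalSpace

/-- Every locally compact T₀ space is a Rudin space. -/
theorem stmt14 (X : Type u) [TopologicalSpace X] [T0Space X]
    (h : LocallyCompactSat X) : RudinSpace X := by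
  intro A hA hAc
  refine ⟨hAc, {K | IsCompactSaturated K ∧ (A ∩ interior K).Nonempty}, ⟨?_, fun K hK ↦ hK.1, ?_⟩,
    fun K hK ↦ hK.2.mono (inter_subset_inter_right A interior_subset), ?_⟩
  · obtain ⟨x, hx⟩ := hA.nonempty
    obtain ⟨K, hK, hxK, -⟩ := h x univ isOpen_univ (mem_univ x)
    exact ⟨K, hK, x, hx, hxK⟩
  · rintro K₁ ⟨-, h₁⟩ K₂ ⟨-, h₂⟩
    obtain ⟨x, hxA, hx⟩ := hA.isPreirreducible _ _ isOpen_interior isOpen_interior h₁ h₂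
    obtain ⟨K, hK, hxK, hKU⟩ := h x _ (isOpen_interior.inter isOpen_interior) hx
    exact ⟨K, ⟨hK, x, hxA, hxK⟩, fun y hy ↦ interior_subset (hKU hy).1,
      fun y hy ↦ interior_subset (hKU hy).2⟩
  · intro B hB hmeet hBA
    refine hBA.antisymm fun x hx ↦ ?_
    by_contra hxB
    obtain ⟨K, hK, hxK, hKU⟩ := h x Bᶜ hB.isOpen_compl hxB
    obtain ⟨y, hyB, hyK⟩ := hmeet K ⟨hK, x, hx, hxK⟩
    exact hKU hyK hyB
end

section
/- Let X be a T₀ space. (i) If X is sober, then for every irreducible closed subset A of X and every nonempty compact saturated set K, the set of maximal elements of A (in the specialization order) is nonempty and ↓(A ∩ K) is closed. (ii) Conversely, if for every irreducible closed subset A of X and every nonempty compact saturated set K the set of maximal elements of A is nonempty and ↓(A ∩ K) is closed, then X is well-filtered. -/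
universe u v

open Set TopologicalSpace

/-- Rudin's lemma: a closed set meeting every member of a filtered family of compact saturated
sets contains a minimal such closed set. -/
theorem FilteredFamily.exists_isClosed_minimal {X : Type u} [TopologicalSpace X]
    {𝒦 : Set (Set X)} (h𝒦 : FilteredFamily 𝒦) {C : Set X} (hC : IsClosed C)
    (hCK : ∀ K ∈ 𝒦, (C ∩ K).Nonempty) :
    ∃ A ⊆ C, Minimal (fun B : Set X => IsClosed B ∧ ∀ K ∈ 𝒦, (B ∩ K).Nonempty) A := by
  refine zorn_superset_nonempty {B : Set X | IsClosed B ∧ ∀ K ∈ 𝒦, (B ∩ K).Nonempty}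
    (fun c hcS hc hcne => ?_) C ⟨hC, hCK⟩
  refine ⟨⋂₀ c, ⟨isClosed_sInter fun B hB => (hcS hB).1, fun K hK => ?_⟩,
    fun B hB => sInter_subset_of_mem hB⟩
  by_contra hne
  have : Nonempty c := hcne.to_subtype
  obtain ⟨B, hB⟩ := (h𝒦.2.1 K hK).2.1.elim_directed_family_closed
    (fun B : c => (B : Set X)) (fun B => (hcS B.2).1)
    (by rwa [← sInter_eq_iInter, inter_comm, ← not_nonempty_iff_eq_empty])
    (IsChain.directedOn (r := fun B C : Set X => B ⊇ C) hc.symm).directed_val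
  exact ((hcS B.2).2 K hK).ne_empty (by rwa [inter_comm])

/-- A closed set that is minimal among those meeting every member of a filtered family of compact
saturated sets is irreducible. -/
theorem FilteredFamily.isIrreducible_of_minimal {X : Type u} [TopologicalSpace X]
    {𝒦 : Set (Set X)} (h𝒦 : FilteredFamily 𝒦) {A : Set X}
    (hA : Minimal (fun B : Set X => IsClosed B ∧ ∀ K ∈ 𝒦, (B ∩ K).Nonempty) A) :
    IsIrreducible A := by
  have key : ∀ Z : Set X, IsClosed Z → ¬ A ⊆ Z → ∃ K ∈ 𝒦, A ∩ Z ∩ K = ∅ := by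
    intro Z hZ hAZ
    by_contra! hmeet
    exact hAZ fun x hx => (hA.le_of_le ⟨hA.prop.1.inter hZ, hmeet⟩ inter_subset_left hx).2
  obtain ⟨K₀, hK₀⟩ := h𝒦.1
  refine ⟨(hA.prop.2 K₀ hK₀).mono inter_subset_left,
    isPreirreducible_iff_isClosed_union_isClosed.2 fun Z₁ Z₂ hZ₁ hZ₂ hAZ => ?_⟩
  by_contra! hnot
  obtain ⟨K₁, hK₁, h₁⟩ := key Z₁ hZ₁ hnot.1
  obtain ⟨K₂, hK₂, h₂⟩ := key Z₂ hZ₂ hnot.2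
  obtain ⟨K₃, hK₃, h₃₁, h₃₂⟩ := h𝒦.2.2 K₁ hK₁ K₂ hK₂
  obtain ⟨a, haA, haK⟩ := hA.prop.2 K₃ hK₃
  rcases hAZ haA with ha | ha
  · exact notMem_empty a (h₁ ▸ ⟨⟨haA, ha⟩, h₃₁ haK⟩)
  · exact notMem_empty a (h₂ ▸ ⟨⟨haA, ha⟩, h₃₂ haK⟩)

/-- The lower set of a subset of a closed set stays inside that closed set. -/
theorem downSet_subset_of_isClosed {X : Type u} [TopologicalSpace X] {A B : Set X}
    (hA : IsClosed A) (hBA : B ⊆ A) : downSet X B ⊆ A := by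
  rintro y ⟨a, ha, hya⟩
  exact closure_minimal (singleton_subset_iff.2 (hBA ha)) hA hya

/-- (i) If `X` is sober then for every irreducible closed `A` and
nonempty compact saturated `K`, `A` has a maximal element and `↓(A ∩ K)` is closed.
(ii) Conversely, if for every such `A` and `K` the set of maximal elements of `A` is
nonempty and `↓(A ∩ K)` is closed, then `X` is well-filtered. -/
theorem stmt17 (X : Type u) [TopologicalSpace X] [T0Space X] :
    (SoberSpace X →
      ∀ A K : Set X, IsIrreducible A → IsClosed A → IsCompactSaturated K →
        (∃ x ∈ A, ∀ y ∈ A, x ∈ closure ({y} : Set X) → y = x) ∧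
          IsClosed (downSet X (A ∩ K))) ∧
    ((∀ A K : Set X, IsIrreducible A → IsClosed A → IsCompactSaturated K →
        (∃ x ∈ A, ∀ y ∈ A, x ∈ closure ({y} : Set X) → y = x) ∧
          IsClosed (downSet X (A ∩ K))) →
      WellFiltered X) := by
  constructor
  · intro hX A K hAirr hAcl hK
    obtain ⟨x, rfl, -⟩ := hX A hAirr hAcl
    have hx : x ∈ closure ({x} : Set X) := subset_closure rfl
    refine ⟨⟨x, hx, fun y hy hxy => ?_⟩, ?_⟩
    · exact (specializes_iff_mem_closure.2 hxy).antisymm (specializes_iff_mem_closure.2 hy) |>.eq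
    · rcases (closure ({x} : Set X) ∩ K).eq_empty_or_nonempty with hempty | ⟨a, hax, haK⟩
      · simp [hempty, downSet]
      · have hdown : downSet X (closure {x} ∩ K) = closure {x} :=
          (downSet_subset_of_isClosed isClosed_closure inter_subset_left).antisymm
            fun y hy => ⟨x, ⟨hx, hK.2.2 a haK x hax⟩, hy⟩
        rw [hdown]
        exact isClosed_closure
  · intro h 𝒦 h𝒦 U hU hUK
    by_contra! hnot
    obtain ⟨A, hAU, hA⟩ := h𝒦.exists_isClosed_minimal hU.isClosed_compl fun K hK => by
      obtain ⟨x, hxK, hxU⟩ := not_subset.1 (hnot K hK)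
      exact ⟨x, hxU, hxK⟩
    have hAirr := h𝒦.isIrreducible_of_minimal hA
    obtain ⟨K₀, hK₀⟩ := h𝒦.1
    obtain ⟨x, hxA, hxmax⟩ := (h A K₀ hAirr hA.prop.1 (h𝒦.2.1 K₀ hK₀)).1
    refine hAU hxA (hUK fun K hK => ?_)
    have hmeet : ∀ K' ∈ 𝒦, (downSet X (A ∩ K) ∩ K').Nonempty := by
      intro K' hK'
      obtain ⟨L, hL, hLK, hLK'⟩ := h𝒦.2.2 K hK K' hK'
      obtain ⟨a, haA, haL⟩ := hA.prop.2 L hL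
      exact ⟨a, ⟨a, ⟨haA, hLK haL⟩, subset_closure rfl⟩, hLK' haL⟩
    obtain ⟨a, ⟨haA, haK⟩, hxa⟩ := hA.le_of_le
      ⟨(h A K hAirr hA.prop.1 (h𝒦.2.1 K hK)).2, hmeet⟩
      (downSet_subset_of_isClosed hA.prop.1 inter_subset_left) hxA
    exact hxmax a haA hxa ▸ haK
end
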